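/- Only colleges c with |μ(c)| = q(c) > 1 can beneficially manipulate the college-optimal stable mechanism via misrepresenting preferences: if a college c can beneficially manipulate the college-optimal stable mechanism while all other agents report truthfully, then the truthful college-optimal stable matching μ satisfies |μ(c)| = q(c) and q(c) > 1. -/

import Mathlib

/-- A college admissions market: capacities `q` (each at least 1) and, for every
student and every college, a strict complete preference list, modelled as a
`LinearOrder` in which *greater* means *more preferred*. -/
structure Market (S C : Type*) [Fintype S] [Fintype C] where
  q : C → ℕ
  q_pos : ∀ c, 1 ≤ q c
  sPref : S → LinearOrder C
  cPref : C → LinearOrder S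

variable {S C : Type*} [Fintype S] [Fintype C]

/-- Student `s` strictly prefers college `c` to college `c'`. -/
def Market.sprefers (M : Market S C) (s : S) (c c' : C) : Prop :=
  (M.sPref s).lt c' c

/-- College `c` strictly prefers student `s` to student `s'`. -/
def Market.cprefers (M : Market S C) (c : C) (s s' : S) : Prop :=
  (M.cPref c).lt s' s

/-- A matching: each college gets a set of students within its capacity, and the
sets of distinct colleges are disjoint (so each student has at most one college). -/
structure Matching (M : Market S C) where
  assign : C → Finset S
  card_le : ∀ c, (assign c).card ≤ M.q c
  disjoint : ∀ c c', c ≠ c' → Disjoint (assign c) (assign c')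

/-- `(s, c)` is a blocking pair: `s` is unmatched or prefers `c` to his current
college, and `c` has a free slot or prefers `s` to one of its current students. -/
def Blocks (M : Market S C) (μ : Matching M) (s : S) (c : C) : Prop :=
  (∀ c', s ∈ μ.assign c' → M.sprefers s c c') ∧
  ((μ.assign c).card < M.q c ∨ ∃ s' ∈ μ.assign c, M.cprefers c s s')

/-- A matching is stable if it admits no blocking pair. -/
def Stable (M : Market S C) (μ : Matching M) : Prop :=
  ∀ s c, ¬ Blocks M μ s c

/-- Student `s` weakly prefers his assignment under `μ` to his assignment under `ν`:
either the assignments coincide, or `s` is matched under `μ` to a college that he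
strictly prefers to his situation under `ν` (being matched beats being unmatched). -/
def SWeakPref (M : Market S C) (μ ν : Matching M) (s : S) : Prop :=
  (∀ c, s ∈ μ.assign c ↔ s ∈ ν.assign c) ∨
  ∃ c, s ∈ μ.assign c ∧
    ((∀ c', s ∉ ν.assign c') ∨ ∃ c', s ∈ ν.assign c' ∧ M.sprefers s c c')

/-- The student-optimal stable matching. -/
def StudentOptimal (M : Market S C) (μ : Matching M) : Prop :=
  Stable M μ ∧ ∀ ν : Matching M, Stable M ν → ∀ s, SWeakPref M μ ν s

/-- `X` (weakly) responsively dominates `Y` w.r.t. college `c`'s preferences: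
there is an injection `g : Y → X` with `g s = s` or `g s >_c s` for all `s ∈ Y`. -/
def RespDominates (M : Market S C) (c : C) (X Y : Finset S) : Prop :=
  ∃ g : S → S, Set.InjOn g ↑Y ∧ (∀ s ∈ Y, g s ∈ X) ∧
    ∀ s ∈ Y, g s = s ∨ M.cprefers c (g s) s

/-- Strict responsive domination. -/
def StrictRespDominates (M : Market S C) (c : C) (X Y : Finset S) : Prop :=
  X ≠ Y ∧ RespDominates M c X Y

/-- The college-optimal stable matching. -/
def CollegeOptimal (M : Market S C) (μ : Matching M) : Prop :=
  Stable M μ ∧ ∀ ν : Matching M, Stable M ν → ∀ c, RespDominates M c (μ.assign c) (ν.assign c)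

/-- The market in which college `c` reports the list `P` instead of its true list,
while everything else is unchanged. -/
def replaceCPref [DecidableEq C] (M : Market S C) (c : C) (P : LinearOrder S) :
    Market S C :=
  { M with cPref := Function.update M.cPref c P }

/-- The market in which student `s` reports the list `P` instead of his true list,
while everything else is unchanged. -/
def replaceSPref [DecidableEq S] (M : Market S C) (s : S) (P : LinearOrder C) :
    Market S C :=
  { M with sPref := Function.update M.sPref s P }

/-- Preferences of a student over the copies of the colleges in the associated
one-to-one market: copies of colleges are compared according to the student's order
over colleges, and within a block of copies smaller index is better. -/
def assocSPref (M : Market S C) (s : S) : LinearOrder ((c : C) × Fin (M.q c)) :=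
  letI := M.sPref s
  LinearOrder.lift' (fun x => toLex ((x.1 : C), (M.q x.1 - (x.2 : ℕ)))) (by
    rintro ⟨c, i⟩ ⟨c', j⟩ h
    have h' : ((c : C), M.q c - (i : ℕ)) = (c', M.q c' - (j : ℕ)) := toLex.injective h
    have h1 : c = c' := congrArg Prod.fst h'
    subst h1
    have h2 : M.q c - (i : ℕ) = M.q c - (j : ℕ) := congrArg Prod.snd h'
    have hi := i.isLt
    have hj := j.isLt
    have : (i : ℕ) = (j : ℕ) := by omega
    exact congrArg (Sigma.mk c) (Fin.ext this))

/-- The associated one-to-one market: college `c` is replaced by `q c` copies,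
each of capacity one and with `c`'s preferences over students; students' preferences
over copies are induced blockwise from their preferences over colleges. -/
def assocMarket (M : Market S C) : Market S ((c : C) × Fin (M.q c)) :=
  { q := fun _ => 1
    q_pos := fun _ => le_refl 1
    sPref := assocSPref M
    cPref := fun x => M.cPref x.1 }

section Preferences

variable (M : Market S C)

lemma Market.cprefers_irrefl (e : C) (s : S) : ¬ M.cprefers e s s :=
  @lt_irrefl _ (M.cPref e).toPreorder s

lemma Market.cprefers_trans {e : C} {s t r : S} (hst : M.cprefers e s t)
    (htr : M.cprefers e t r) : M.cprefers e s r :=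
  @lt_trans _ (M.cPref e).toPreorder _ _ _ htr hst

lemma Market.cprefers_trichotomy (e : C) (s t : S) :
    M.cprefers e s t ∨ s = t ∨ M.cprefers e t s := by
  let := M.cPref e
  rcases lt_trichotomy t s with h | h | h
  exacts [Or.inl h, Or.inr (Or.inl h.symm), Or.inr (Or.inr h)]

lemma Market.sprefers_irrefl (s : S) (d : C) : ¬ M.sprefers s d d :=
  @lt_irrefl _ (M.sPref s).toPreorder d

lemma Market.sprefers_trans {s : S} {d e f : C} (hde : M.sprefers s d e)
    (hef : M.sprefers s e f) : M.sprefers s d f :=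
  @lt_trans _ (M.sPref s).toPreorder _ _ _ hef hde

lemma Market.sprefers_trichotomy (s : S) (d e : C) :
    M.sprefers s d e ∨ d = e ∨ M.sprefers s e d := by
  let := M.sPref s
  rcases lt_trichotomy e d with h | h | h
  exacts [Or.inl h, Or.inr (Or.inl h.symm), Or.inr (Or.inr h)]

/-- A nonempty set of students has a member that college `e` likes best. -/
lemma Market.exists_best_student (e : C) {B : Finset S} (hB : B.Nonempty) :
    ∃ s ∈ B, ∀ t ∈ B, ¬ M.cprefers e t s := by
  let := M.cPref e
  obtain ⟨s, hs, h⟩ := B.exists_max_image id hB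
  exact ⟨s, hs, fun t ht => not_lt_of_ge (h t ht)⟩

/-- A nonempty set of students has a member that college `e` likes least. -/
lemma Market.exists_worst_student (e : C) {B : Finset S} (hB : B.Nonempty) :
    ∃ s ∈ B, ∀ t ∈ B, ¬ M.cprefers e s t := by
  let := M.cPref e
  obtain ⟨s, hs, h⟩ := B.exists_min_image id hB
  exact ⟨s, hs, fun t ht => not_lt_of_ge (h t ht)⟩

/-- A satisfiable property of colleges has a witness that student `s` likes best. -/
lemma Market.exists_best_college (s : S) {p : C → Prop} (hp : ∃ d, p d) :
    ∃ d, p d ∧ ∀ e, M.sprefers s e d → ¬ p e := by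
  let := M.sPref s
  obtain ⟨d, hd, h⟩ := Set.exists_max_image {d | p d} id (Set.toFinite _) hp
  exact ⟨d, hd, fun e he hpe => not_lt_of_ge (h e hpe) he⟩

end Preferences

section DeferredAcceptance

open scoped Classical in
/-- The members of `B` that have fewer than `q e` superiors in `B` according to college `e`. -/
noncomputable def Market.top (M : Market S C) (e : C) (B : Finset S) : Finset S :=
  B.filter fun t => (B.filter fun r => M.cprefers e r t).card < M.q e

open scoped Classical in
lemma Market.mem_top {M : Market S C} {e : C} {B : Finset S} {t : S} :
    t ∈ M.top e B ↔ t ∈ B ∧ (B.filter fun r => M.cprefers e r t).card < M.q e := by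
  simp [Market.top]

lemma Market.mem_top_of_cprefers {M : Market S C} {e : C} {B : Finset S} {s t : S}
    (ht : t ∈ M.top e B) (hs : s ∈ B) (h : M.cprefers e s t) : s ∈ M.top e B := by
  classical
  rw [Market.mem_top] at ht ⊢
  refine ⟨hs, lt_of_le_of_lt (Finset.card_le_card ?_) ht.2⟩
  intro r hr
  rw [Finset.mem_filter] at hr ⊢
  exact ⟨hr.1, M.cprefers_trans hr.2 h⟩

lemma Market.card_top (M : Market S C) (e : C) (B : Finset S) :
    (M.top e B).card = min (M.q e) B.card := by
  classical
  have hsub : M.top e B ⊆ B := Finset.filter_subset _ _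
  refine le_antisymm (le_min ?_ (Finset.card_le_card hsub)) ?_
  · rcases (M.top e B).eq_empty_or_nonempty with h | h
    · simp [h]
    · obtain ⟨s, hs, hworst⟩ := M.exists_worst_student e h
      have hcard := (Market.mem_top.1 hs).2
      have hle : ((M.top e B).erase s).card ≤ (B.filter fun r => M.cprefers e r s).card := by
        refine Finset.card_le_card fun r hr => ?_
        rw [Finset.mem_erase] at hr
        rw [Finset.mem_filter]
        refine ⟨hsub hr.2, ?_⟩
        rcases M.cprefers_trichotomy e r s with h' | h' | h'
        exacts [h', absurd h' hr.1, absurd h' (hworst r hr.2)]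
      rw [Finset.card_erase_of_mem hs] at hle
      omega
  · by_cases hB : (B \ M.top e B).Nonempty
    · obtain ⟨s, hs, hbest⟩ := M.exists_best_student e hB
      rw [Finset.mem_sdiff] at hs
      have hge : M.q e ≤ (B.filter fun r => M.cprefers e r s).card := by
        by_contra hlt
        exact hs.2 (Market.mem_top.2 ⟨hs.1, not_le.1 hlt⟩)
      refine (min_le_left _ _).trans (hge.trans (Finset.card_le_card fun r hr => ?_))
      rw [Finset.mem_filter] at hr
      by_contra hr'
      exact hbest r (Finset.mem_sdiff.2 ⟨hr.1, hr'⟩) hr.2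
    · rw [Finset.not_nonempty_iff_eq_empty, Finset.sdiff_eq_empty_iff_subset] at hB
      exact (min_le_right _ _).trans (Finset.card_le_card hB)

variable (M : Market S C) (L : C → S → Prop)

/-- If `X t e` means that `t` holds an offer at least as good as `e`, then student `t` would not
lose by moving to college `e`. -/
def Market.Avail (X : S → C → Prop) (t : S) (e : C) : Prop :=
  ∀ e', M.sprefers t e' e → ¬ X t e'

open scoped Classical in
/-- The students acceptable to `e` (according to `L`) that are available to `e`. -/
noncomputable def Market.pool (X : S → C → Prop) (e : C) : Finset S :=
  Finset.univ.filter fun t => L e t ∧ M.Avail X t e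

open scoped Classical in
/-- College `e` makes an offer to the acceptable student `s`: fewer than `q e` students in the
pool of `e` are better than `s`. -/
def Market.Offer (X : S → C → Prop) (e : C) (s : S) : Prop :=
  L e s ∧ ((M.pool L X e).filter fun r => M.cprefers e r s).card < M.q e

variable {M L}

lemma Market.mem_pool {X : S → C → Prop} {e : C} {t : S} :
    t ∈ M.pool L X e ↔ L e t ∧ M.Avail X t e := by
  simp [Market.pool]

lemma Market.pool_anti {X Y : S → C → Prop} (h : X ≤ Y) (e : C) :
    M.pool L Y e ⊆ M.pool L X e := by
  intro t ht
  rw [Market.mem_pool] at ht ⊢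
  exact ⟨ht.1, fun e' he' hX => ht.2 e' he' (h t e' hX)⟩

variable (M L)

/-- One round of college-proposing deferred acceptance, in which college `e` regards exactly the
students satisfying `L e` as acceptable. -/
def Market.proposal : (S → C → Prop) →o (S → C → Prop) where
  toFun X s d := ∃ e, (e = d ∨ M.sprefers s e d) ∧ M.Offer L X e s
  monotone' X Y h := by
    classical
    rintro s d ⟨e, hed, hL, hcard⟩
    exact ⟨e, hed, hL, lt_of_le_of_lt
      (Finset.card_le_card (Finset.filter_subset_filter _ (Market.pool_anti h e))) hcard⟩

open scoped Classical in
/-- The students whose best held offer according to `X` is from college `e`. -/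
noncomputable def Market.held (X : S → C → Prop) (e : C) : Finset S :=
  Finset.univ.filter fun s => X s e ∧ M.Avail X s e

variable {M L} {X Y : S → C → Prop}

lemma Market.mem_held {e : C} {s : S} : s ∈ M.held X e ↔ X s e ∧ M.Avail X s e := by
  simp [Market.held]

lemma Market.proposal_apply {s : S} {d : C} :
    M.proposal L X s d ↔ ∃ e, (e = d ∨ M.sprefers s e d) ∧ M.Offer L X e s := Iff.rfl

lemma Market.apply_iff_of_fixed (hX : M.proposal L X = X) {s : S} {d : C} :
    X s d ↔ ∃ e, (e = d ∨ M.sprefers s e d) ∧ M.Offer L X e s := by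
  conv_lhs => rw [← hX]
  exact Market.proposal_apply

/-- At a fixed point, every college holds the best students of its pool. -/
lemma Market.held_eq_top (hX : M.proposal L X = X) (e : C) :
    M.held X e = M.top e (M.pool L X e) := by
  classical
  ext s
  rw [Market.mem_held, Market.mem_top, Market.mem_pool]
  constructor
  · rintro ⟨hs, hav⟩
    obtain ⟨e', he', hoff⟩ := (Market.apply_iff_of_fixed hX).1 hs
    rcases he' with rfl | he'
    · exact ⟨⟨hoff.1, hav⟩, hoff.2⟩
    · exact absurd ((Market.apply_iff_of_fixed hX).2 ⟨e', Or.inl rfl, hoff⟩) (hav e' he')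
  · rintro ⟨⟨hL, hav⟩, hcard⟩
    exact ⟨(Market.apply_iff_of_fixed hX).2 ⟨e, Or.inl rfl, hL, hcard⟩, hav⟩

lemma Market.held_disjoint {d e : C} (hde : d ≠ e) : Disjoint (M.held X d) (M.held X e) := by
  rw [Finset.disjoint_left]
  intro s hd he
  rw [Market.mem_held] at hd he
  rcases M.sprefers_trichotomy s d e with h | h | h
  exacts [he.2 d h hd.1, hde h, hd.2 e h he.1]

/-- The matching determined by a fixed point of deferred acceptance. -/
noncomputable def Market.heldMatching (hX : M.proposal L X = X) : Matching M where
  assign := M.held X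
  card_le e := by
    rw [Market.held_eq_top hX, Market.card_top]
    exact min_le_left _ _
  disjoint _ _ h := Market.held_disjoint h

/-- No acceptable student takes part in a blocking pair of the matching determined by a fixed
point. -/
lemma Market.not_blocks_heldMatching (hX : M.proposal L X = X) {s : S} {e : C} (hL : L e s) :
    ¬ Blocks M (M.heldMatching hX) s e := by
  classical
  rintro ⟨hpref, hcol⟩
  change ∀ d, s ∈ M.held X d → M.sprefers s e d at hpref
  change (M.held X e).card < M.q e ∨ ∃ t ∈ M.held X e, M.cprefers e s t at hcol
  have hnot : s ∉ M.held X e := fun h => M.sprefers_irrefl s e (hpref e h)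
  have hpool : s ∈ M.pool L X e := by
    refine Market.mem_pool.2 ⟨hL, fun d hd hXd => ?_⟩
    obtain ⟨b, ⟨hXb, hb⟩, hbest⟩ := M.exists_best_college s
      (p := fun b => X s b ∧ M.sprefers s b e) ⟨d, hXd, hd⟩
    have hheld : s ∈ M.held X b :=
      Market.mem_held.2 ⟨hXb, fun f hf hXf => hbest f hf ⟨hXf, M.sprefers_trans hf hb⟩⟩
    exact M.sprefers_irrefl s e (M.sprefers_trans (hpref b hheld) hb)
  rw [Market.held_eq_top hX] at hcol hnot
  rcases hcol with hcard | ⟨t, ht, hst⟩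
  · have hsub : M.top e (M.pool L X e) ⊆ M.pool L X e := Finset.filter_subset _ _
    have hle : (M.pool L X e).card ≤ (M.top e (M.pool L X e)).card := by
      rw [Market.card_top] at hcard ⊢
      omega
    exact hnot ((Finset.eq_of_subset_of_card_le hsub hle).symm ▸ hpool)
  · exact hnot (Market.mem_top_of_cprefers ht hpool hst)

/-- The students held by some college are those holding some offer. -/
lemma Market.sum_card_held [DecidableEq S] (X : S → C → Prop) [DecidablePred fun s => ∃ d, X s d] :
    ∑ e, (M.held X e).card = (Finset.univ.filter fun s => ∃ d, X s d).card := by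
  rw [← Finset.card_biUnion fun d _ e _ h => Market.held_disjoint h]
  congr 1
  ext s
  simp only [Finset.mem_biUnion, Finset.mem_univ, true_and, Finset.mem_filter]
  constructor
  · rintro ⟨e, he⟩
    exact ⟨e, (Market.mem_held.1 he).1⟩
  · intro h
    obtain ⟨d, hd, hbest⟩ := M.exists_best_college s h
    exact ⟨d, Market.mem_held.2 ⟨hd, hbest⟩⟩

/-- Comparable fixed points fill the same number of positions at every college. -/
lemma Market.card_held_eq_of_le (hX : M.proposal L X = X) (hY : M.proposal L Y = Y)
    (h : X ≤ Y) (e : C) : (M.held X e).card = (M.held Y e).card := by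
  classical
  have hle : ∀ d ∈ Finset.univ, (M.held Y d).card ≤ (M.held X d).card := by
    intro d _
    rw [Market.held_eq_top hX, Market.held_eq_top hY, Market.card_top, Market.card_top]
    exact min_le_min_left _ (Finset.card_le_card (Market.pool_anti h d))
  have hsum : ∑ d, (M.held X d).card ≤ ∑ d, (M.held Y d).card := by
    rw [Market.sum_card_held, Market.sum_card_held]
    refine Finset.card_le_card fun s hs => ?_
    rw [Finset.mem_filter] at hs ⊢
    obtain ⟨hs, d, hd⟩ := hs
    exact ⟨hs, d, h s d hd⟩
  exact ((Finset.sum_eq_sum_iff_of_le hle).1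
    (le_antisymm (Finset.sum_le_sum hle) hsum) e (Finset.mem_univ e)).symm

end DeferredAcceptance

lemma RespDominates.card_le {M : Market S C} {c : C} {A B : Finset S}
    (h : RespDominates M c A B) : B.card ≤ A.card := by
  obtain ⟨g, hinj, hmem, -⟩ := h
  exact Finset.card_le_card_of_injOn g hmem hinj

/-- A college with a free position in some stable matching has the same students in the
college-optimal one. -/
lemma CollegeOptimal.assign_eq_of_card_lt {M : Market S C} {μ ν : Matching M}
    (hμ : CollegeOptimal M μ) (hν : Stable M ν) {c : C} (hc : (ν.assign c).card < M.q c) :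
    μ.assign c = ν.assign c := by
  classical
  have hmatched : ∀ s, ∃ d, s ∈ ν.assign d := by
    intro s
    by_contra! h
    exact hν s c ⟨fun d hd => absurd hd (h d), Or.inl hc⟩
  have hle : ∀ d ∈ Finset.univ, (ν.assign d).card ≤ (μ.assign d).card :=
    fun d _ => (hμ.2 ν hν d).card_le
  have hsum : ∑ d, (μ.assign d).card ≤ ∑ d, (ν.assign d).card := by
    rw [← Finset.card_biUnion fun d _ e _ h => μ.disjoint d e h,
      ← Finset.card_biUnion fun d _ e _ h => ν.disjoint d e h]
    refine Finset.card_le_card fun s _ => ?_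
    simpa using hmatched s
  have hcard : ∀ d, (ν.assign d).card = (μ.assign d).card := fun d =>
    (Finset.sum_eq_sum_iff_of_le hle).1
      (le_antisymm (Finset.sum_le_sum hle) hsum) d (Finset.mem_univ d)
  refine (Finset.eq_of_subset_of_card_le (fun s hs => ?_) (hcard c).ge).symm
  by_contra hs'
  have hnb := hμ.1 s c
  simp only [Blocks, not_and_or, not_forall] at hnb
  rcases hnb with ⟨d, hd, hpref⟩ | hnb
  · have hdc : d ≠ c := fun h => hs' (h ▸ hd)
    have hdpref : M.sprefers s d c := by
      rcases M.sprefers_trichotomy s d c with h | h | h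
      exacts [h, absurd h hdc, absurd h hpref]
    have huniq : ∀ e, s ∈ ν.assign e → e = c := by
      intro e he
      by_contra hec
      exact Finset.disjoint_left.1 (ν.disjoint e c hec) he hs
    obtain ⟨g, hinj, hmem, himp⟩ := hμ.2 ν hν d
    obtain ⟨t, ht, rfl⟩ :=
      Finset.surjOn_of_injOn_of_card_le g hmem hinj (hcard d).ge hd
    rcases himp t ht with h | h
    · rw [← h] at ht
      exact hdc (huniq d ht)
    · exact hν (g t) d ⟨fun e he => huniq e he ▸ hdpref, Or.inr ⟨t, ht, h⟩⟩
  · exact hnb (Or.inl (hcard c ▸ hc))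

section Manipulation

variable [DecidableEq C] {M : Market S C} {c : C} {P : LinearOrder S}

lemma replaceCPref_cprefers_of_ne {e : C} (h : e ≠ c) {s t : S} :
    (replaceCPref M c P).cprefers e s t ↔ M.cprefers e s t := by
  have hpref : (replaceCPref M c P).cPref e = M.cPref e := Function.update_of_ne h _ _
  unfold Market.cprefers
  rw [hpref]

/-- A stable matching in which `c` has a free position stays stable under any report of `c`. -/
lemma Stable.replaceCPref_of_card_lt {μ : Matching M} (hμ : Stable M μ)
    (hc : (μ.assign c).card < M.q c) :
    Stable (replaceCPref M c P) ⟨μ.assign, μ.card_le, μ.disjoint⟩ := by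
  rintro s d ⟨hpref, hcol⟩
  refine hμ s d ⟨hpref, ?_⟩
  by_cases hd : d = c
  · exact Or.inl (hd ▸ hc)
  · refine hcol.imp id ?_
    rintro ⟨t, ht, h⟩
    exact ⟨t, ht, (replaceCPref_cprefers_of_ne hd).1 h⟩

/-- If `c` obtains `s` in a stable matching under some report, then the offers held in that
matching are closed under deferred acceptance in which `c` only accepts `s`. -/
lemma proposal_le_of_stable_replaceCPref {μ' : Matching (replaceCPref M c P)}
    (hμ' : Stable (replaceCPref M c P) μ') {s : S} (hs : s ∈ μ'.assign c) :
    M.proposal (fun e t => e = c → t = s)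
      (fun t d => ∃ e, t ∈ μ'.assign e ∧ (e = d ∨ M.sprefers t e d)) ≤
      fun t d => ∃ e, t ∈ μ'.assign e ∧ (e = d ∨ M.sprefers t e d) := by
  classical
  rintro t d ⟨e, hed, hL, hcard⟩
  suffices h : ∃ f, t ∈ μ'.assign f ∧ (f = e ∨ M.sprefers t f e) by
    obtain ⟨f, hf, hfe⟩ := h
    refine ⟨f, hf, ?_⟩
    rcases hfe with rfl | hfe
    · exact hed
    · rcases hed with rfl | hed
      exacts [Or.inr hfe, Or.inr (M.sprefers_trans hfe hed)]
  by_contra! hnot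
  have hec : e ≠ c := by
    rintro rfl
    exact (hnot e (hL rfl ▸ hs)).1 rfl
  have hpref : ∀ f, t ∈ μ'.assign f → M.sprefers t e f := by
    intro f hf
    rcases M.sprefers_trichotomy t e f with h | h | h
    exacts [h, absurd h.symm (hnot f hf).1, absurd h (hnot f hf).2]
  have hnb := hμ' t e
  simp only [Blocks, not_and, not_or, not_lt, not_exists] at hnb
  obtain ⟨hfull, hbetter⟩ := hnb hpref
  refine absurd (hfull.trans (Finset.card_le_card fun r hr => ?_)) (not_le.2 hcard)
  rw [Finset.mem_filter, Market.mem_pool]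
  refine ⟨⟨fun h => absurd h hec, ?_⟩, ?_⟩
  · rintro e' he' ⟨f, hf, hfe'⟩
    have hfe : f = e := by
      by_contra hne
      exact Finset.disjoint_left.1 (μ'.disjoint f e hne) hf hr
    subst hfe
    rcases hfe' with rfl | h
    · exact M.sprefers_irrefl r _ he'
    · exact M.sprefers_irrefl r _ (M.sprefers_trans h he')
  · rcases M.cprefers_trichotomy e r t with h | h | h
    · exact h
    · exact absurd rfl (hnot e (h ▸ hr)).1
    · exact absurd ((replaceCPref_cprefers_of_ne hec).2 h) (hbetter r hr)

/-- If `c` obtains `s` in a stable matching under some report, then in deferred acceptance with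
the list of `c` truncated below `s`, college `c` is matched. -/
lemma held_nonempty_of_truncation {μ' : Matching (replaceCPref M c P)}
    (hμ' : Stable (replaceCPref M c P) μ') {s : S} (hs : s ∈ μ'.assign c)
    {Y : S → C → Prop}
    (hY : M.proposal (fun e t => e = c → t = s ∨ M.cprefers c t s) Y = Y) :
    (M.held Y c).Nonempty := by
  classical
  rw [Finset.nonempty_iff_ne_empty]
  intro hempty
  have hq := M.q_pos c
  have hpool : M.pool (fun e t => e = c → t = s ∨ M.cprefers c t s) Y c = ∅ := by
    have h := M.card_top c (M.pool (fun e t => e = c → t = s ∨ M.cprefers c t s) Y c)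
    rw [← Market.held_eq_top hY, hempty, Finset.card_empty] at h
    exact Finset.card_eq_zero.1 (by omega)
  have hunavail : ∀ t, (t = s ∨ M.cprefers c t s) → ¬ M.Avail Y t c := by
    intro t ht hav
    exact Finset.notMem_empty t (hpool ▸ Market.mem_pool.2 ⟨fun _ => ht, hav⟩)
  -- Offers of other colleges do not depend on what `c` accepts.
  have hoffer : ∀ e t, e ≠ c → (M.Offer (fun e t => e = c → t = s ∨ M.cprefers c t s) Y e t ↔
      M.Offer (fun e t => e = c → t = s) Y e t) := by
    intro e t he
    simp [Market.Offer, Market.pool, he]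
  have hother : ∀ t d, (t = s ∨ M.cprefers c t s) → (c = d ∨ M.sprefers t c d) →
      ∃ e, e ≠ c ∧ (e = d ∨ M.sprefers t e d) ∧
        M.Offer (fun e t => e = c → t = s ∨ M.cprefers c t s) Y e t := by
    intro t d ht hd
    have h := hunavail t ht
    simp only [Market.Avail, not_forall, not_not] at h
    obtain ⟨e', he', hYe'⟩ := h
    obtain ⟨e, hee', hoff⟩ := (Market.apply_iff_of_fixed hY).1 hYe'
    have hec : M.sprefers t e c := by
      rcases hee' with rfl | hee'
      exacts [he', M.sprefers_trans hee' he']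
    refine ⟨e, ?_, ?_, hoff⟩
    · rintro rfl
      exact M.sprefers_irrefl t e hec
    · rcases hd with rfl | hd
      exacts [Or.inr hec, Or.inr (M.sprefers_trans hec hd)]
  have hY' : M.proposal (fun e t => e = c → t = s) Y = Y := by
    ext t d
    rw [Market.apply_iff_of_fixed hY, Market.proposal_apply]
    refine Iff.symm ⟨?_, ?_⟩
    · rintro ⟨e, hed, hoff⟩
      by_cases he : e = c
      · subst he
        obtain ⟨f, hf, hfd, hoff'⟩ := hother t d (hoff.1 rfl) hed
        exact ⟨f, hfd, (hoffer f t hf).1 hoff'⟩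
      · exact ⟨e, hed, (hoffer e t he).1 hoff⟩
    · rintro ⟨e, hed, hoff⟩
      by_cases he : e = c
      · subst he
        obtain ⟨f, -, hf⟩ := hother t d (Or.inl (hoff.1 rfl)) hed
        exact ⟨f, hf⟩
      · exact ⟨e, hed, (hoffer e t he).2 hoff⟩
  set X := OrderHom.lfp (M.proposal fun e t => e = c → t = s)
  have hX : M.proposal (fun e t => e = c → t = s) X = X := OrderHom.map_lfp _
  have hXY : X ≤ Y := OrderHom.lfp_le _ hY'.le
  have hXμ' : X ≤ _ := OrderHom.lfp_le _ (proposal_le_of_stable_replaceCPref hμ' hs)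
  have hmem : s ∈ M.held X c := by
    rw [Market.held_eq_top hX, Market.mem_top, Market.mem_pool]
    refine ⟨⟨fun _ => rfl, fun e he hXe => ?_⟩, ?_⟩
    · obtain ⟨f, hf, hfe⟩ := hXμ' s e hXe
      have hfc : f = c := by
        by_contra hne
        exact Finset.disjoint_left.1 (μ'.disjoint f c hne) hf hs
      subst hfc
      rcases hfe with rfl | h
      · exact M.sprefers_irrefl s _ he
      · exact M.sprefers_irrefl s _ (M.sprefers_trans h he)
    · rw [Finset.filter_eq_empty_iff.2, Finset.card_empty]
      · exact hq
      · intro r hr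
        rw [(Market.mem_pool.1 hr).1 rfl]
        exact M.cprefers_irrefl c s
  have hcard := Market.card_held_eq_of_le hX hY' hXY c
  rw [hempty, Finset.card_empty, Finset.card_eq_zero] at hcard
  simp [hcard] at hmem

/-- If a college with a single position obtains `s` in a stable matching under some report, then
truthfully there is a stable matching that gives it `s` or a better student. -/
lemma exists_stable_of_stable_replaceCPref (hq : M.q c = 1)
    {μ' : Matching (replaceCPref M c P)} (hμ' : Stable (replaceCPref M c P) μ') {s : S}
    (hs : s ∈ μ'.assign c) :
    ∃ ν : Matching M, Stable M ν ∧ ∃ t ∈ ν.assign c, t = s ∨ M.cprefers c t s := by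
  have hY : M.proposal (fun e t => e = c → t = s ∨ M.cprefers c t s)
      (OrderHom.lfp (M.proposal fun e t => e = c → t = s ∨ M.cprefers c t s)) =
      OrderHom.lfp (M.proposal fun e t => e = c → t = s ∨ M.cprefers c t s) :=
    OrderHom.map_lfp _
  obtain ⟨t, ht⟩ := held_nonempty_of_truncation hμ' hs hY
  have hts : ∀ r ∈ (M.heldMatching hY).assign c, r = s ∨ M.cprefers c r s := by
    intro r hr
    change r ∈ M.held _ c at hr
    rw [Market.held_eq_top hY, Market.mem_top, Market.mem_pool] at hr
    exact hr.1.1 rfl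
  refine ⟨M.heldMatching hY, fun r e hb => ?_, t, ht, hts t ht⟩
  refine Market.not_blocks_heldMatching hY ?_ hb
  rintro rfl
  rcases hb.2 with h | ⟨w, hw, h⟩
  · have : 0 < ((M.heldMatching hY).assign e).card := Finset.card_pos.2 ⟨t, ht⟩
    omega
  · rcases hts w hw with rfl | hws
    exacts [Or.inr h, Or.inr (M.cprefers_trans h hws)]

end Manipulation

/-- Only colleges `c` with `|μ(c)| = q c > 1` can beneficially
manipulate the college-optimal stable mechanism via misrepresenting preferences,
where `μ` is the truthful college-optimal stable matching. -/
theorem stmt_13 {S C : Type*} [Fintype S] [Fintype C] [DecidableEq C]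
    (M : Market S C) (c : C) (P : LinearOrder S)
    (μ : Matching M) (μ' : Matching (replaceCPref M c P))
    (hμ : CollegeOptimal M μ) (hμ' : CollegeOptimal (replaceCPref M c P) μ')
    (hben : StrictRespDominates M c (μ'.assign c) (μ.assign c)) :
    (μ.assign c).card = M.q c ∧ 1 < M.q c := by
  have hfull : (μ.assign c).card = M.q c := by
    by_contra hne
    have hlt : (μ.assign c).card < M.q c := lt_of_le_of_ne (μ.card_le c) hne
    exact hben.1 (hμ'.assign_eq_of_card_lt (hμ.1.replaceCPref_of_card_lt hlt) hlt)
  refine ⟨hfull, lt_of_le_of_ne (M.q_pos c) fun hq => ?_⟩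
  obtain ⟨s, hs⟩ := Finset.card_eq_one.1 (hfull.trans hq.symm)
  obtain ⟨hne, g, -, hmem, himp⟩ := hben
  have hsμ : s ∈ μ.assign c := by simp [hs]
  have hg := hmem s hsμ
  have hgs : M.cprefers c (g s) s := by
    refine (himp s hsμ).resolve_left fun h => hne ?_
    rw [h] at hg
    have hle : (μ'.assign c).card ≤ M.q c := μ'.card_le c
    rw [hs]
    refine (Finset.eq_of_subset_of_card_le (by simpa using hg) ?_).symm
    simpa [hq] using hle
  obtain ⟨ν, hν, t, ht, htg⟩ := exists_stable_of_stable_replaceCPref hq.symm hμ'.1 hg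
  have hts : M.cprefers c t s := by
    rcases htg with rfl | h
    exacts [hgs, M.cprefers_trans h hgs]
  obtain ⟨f, -, hfmem, hfimp⟩ := hμ.2 ν hν c
  have hft : f t = s := by simpa [hs] using hfmem t ht
  rcases hfimp t ht with h | h
  · rw [← h, hft] at hts
    exact M.cprefers_irrefl c s hts
  · rw [hft] at h
    exact M.cprefers_irrefl c s (M.cprefers_trans h hts)
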